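/- arXiv:1810.11410 — 2 statements merged into one kernel-verified Lean document; each statement's English description precedes it below -/
import Mathlib

section
/- For every x ∈ ℂ with x ≠ 0 and x² ∉ {q^r : r ∈ ℤ} (so that no theta factor vanishes), one has ∏_{i=1}^{N} 𝒰(q^i x) = 1. -/
open Complex

noncomputable section

/-- single infinite Pochhammer symbol `(x;s)_∞`. -/
def poch1 (x s : ℂ) : ℂ := ∏' n : ℕ, (1 - x * s ^ n)

/-- Jacobi `Θ_s(x)` function. -/
def ThetaF (s x : ℂ) : ℂ := poch1 x s * poch1 (s * x⁻¹) s * poch1 s s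

/-- the function `𝒰(x) = q^{2/N-2} Θ_{q^{2N}}(q²x²) Θ_{q^{2N}}(q²x⁻²) /
(Θ_{q^{2N}}(x²) Θ_{q^{2N}}(x⁻²))` for a real number `q ∈ (0,1)`. -/
def Ureal (N : ℕ) (q : ℝ) (x : ℂ) : ℂ :=
  ((q ^ ((2 : ℝ) / N - 2) : ℝ) : ℂ) * ThetaF ((q : ℂ) ^ (2 * N)) ((q : ℂ) ^ 2 * x ^ 2) *
    ThetaF ((q : ℂ) ^ (2 * N)) ((q : ℂ) ^ 2 * (x⁻¹) ^ 2) /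
    (ThetaF ((q : ℂ) ^ (2 * N)) (x ^ 2) * ThetaF ((q : ℂ) ^ (2 * N)) ((x⁻¹) ^ 2))

lemma aux_summable (x s : ℂ) (hs : ‖s‖ < 1) : Summable (fun n : ℕ => ‖-(x * s ^ n)‖) := by
  simp only [norm_neg, norm_mul, norm_pow]
  exact (summable_geometric_of_lt_one (norm_nonneg _) hs).mul_left _

lemma poch1_ne_zero (x s : ℂ) (hs : ‖s‖ < 1) (h : ∀ n : ℕ, x * s ^ n ≠ 1) :
    poch1 x s ≠ 0 := by
  have := tprod_one_add_ne_zero_of_summable (f := fun n : ℕ => -(x * s ^ n))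
    (fun n h0 => h n (by linear_combination -h0)) (aux_summable x s hs)
  simpa only [poch1, sub_eq_add_neg] using this

lemma poch1_step (x s : ℂ) (hs : ‖s‖ < 1) : poch1 x s = (1 - x) * poch1 (s * x) s := by
  have hm := multipliable_one_add_of_summable (aux_summable (s * x) s hs)
  have he : (fun n : ℕ => 1 + -(s * x * s ^ n)) = fun n : ℕ => 1 - x * s ^ (n + 1) := by
    funext n; ring
  rw [he] at hm
  have h := tprod_eq_zero_mul' (f := fun n : ℕ => 1 - x * s ^ n) hm
  unfold poch1
  rw [h]
  have he2 : (fun n : ℕ => 1 - x * s ^ (n + 1)) = fun n : ℕ => 1 - (s * x * s ^ n) := by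
    funext n; ring
  simp only [he2, pow_zero, mul_one]

lemma ThetaF_step (s z : ℂ) (hs : ‖s‖ < 1) (hs0 : s ≠ 0) (hz : z ≠ 0) (hz1 : z ≠ 1) :
    ThetaF s (s * z) = -z⁻¹ * ThetaF s z := by
  unfold ThetaF
  have e : s * (s * z)⁻¹ = z⁻¹ := by field_simp
  rw [e, poch1_step z s hs, poch1_step z⁻¹ s hs]
  field_simp
  ring

lemma ThetaF_ne_zero (N : ℕ) (hN : 2 ≤ N) (q : ℝ) (hq0 : 0 < q) (hq1 : q < 1)
    (y : ℂ) (hy0 : y ≠ 0) (hy : ∀ r : ℤ, y ≠ (q : ℂ) ^ r) (k : ℤ) :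
    ThetaF ((q : ℂ) ^ (2 * N)) ((q : ℂ) ^ k * y) ≠ 0 := by
  have hqc : (q : ℂ) ≠ 0 := by exact_mod_cast hq0.ne'
  have hs : ‖(q : ℂ) ^ (2 * N)‖ < 1 := by
    rw [norm_pow, Complex.norm_real, Real.norm_of_nonneg hq0.le]
    exact pow_lt_one₀ hq0.le hq1 (by omega)
  unfold ThetaF
  refine mul_ne_zero (mul_ne_zero ?_ ?_) ?_
  · refine poch1_ne_zero _ _ hs fun n h => hy (-(k + 2 * N * n)) ?_
    rw [zpow_neg, zpow_add₀ hqc]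
    rw [← pow_mul] at h
    have e : (q : ℂ) ^ (2 * (N : ℤ) * n) = (q : ℂ) ^ (2 * N * n) := by
      exact_mod_cast zpow_natCast (q : ℂ) (2 * N * n)
    rw [e]
    apply eq_inv_of_mul_eq_one_left
    linear_combination h
  · refine poch1_ne_zero _ _ hs fun n h => hy (2 * N * (n + 1) - k) ?_
    rw [zpow_sub₀ hqc]
    have e : (q : ℂ) ^ (2 * (N : ℤ) * (n + 1)) = (q : ℂ) ^ (2 * N * (n + 1)) := by
      exact_mod_cast zpow_natCast (q : ℂ) (2 * N * (n + 1))
    rw [e, pow_mul (q : ℂ) (2 * N) (n + 1), pow_succ]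
    have hk : (q : ℂ) ^ k ≠ 0 := zpow_ne_zero _ hqc
    field_simp at h ⊢
    linear_combination -h
  · refine poch1_ne_zero _ _ hs fun n h => ?_
    rw [← pow_succ'] at h
    have h2 := congrArg norm h
    rw [norm_pow, norm_one] at h2
    exact absurd h2 (pow_lt_one₀ (norm_nonneg _) hs (by omega)).ne

/-- `∏_{i=1}^{N} 𝒰(qⁱ x) = 1`. -/
theorem prod_U_eq_one (N : ℕ) (hN : 2 ≤ N) (q : ℝ) (hq0 : 0 < q) (hq1 : q < 1)
    (x : ℂ) (hx : x ≠ 0) (hx2 : ∀ r : ℤ, x ^ 2 ≠ (q : ℂ) ^ r) :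
    ∏ i ∈ Finset.Icc 1 N, Ureal N q ((q : ℂ) ^ i * x) = 1 := by
  have hqc : (q : ℂ) ≠ 0 := by exact_mod_cast hq0.ne'
  have hs : ‖(q : ℂ) ^ (2 * N)‖ < 1 := by
    rw [norm_pow, Complex.norm_real, Real.norm_of_nonneg hq0.le]
    exact pow_lt_one₀ hq0.le hq1 (by omega)
  have hs0 : (q : ℂ) ^ (2 * N) ≠ 0 := pow_ne_zero _ hqc
  have hy0 : x ^ 2 ≠ 0 := pow_ne_zero _ hx
  have hy' : ∀ r : ℤ, (x ^ 2)⁻¹ ≠ (q : ℂ) ^ r := by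
    intro r h
    apply hx2 (-r)
    rw [zpow_neg, ← h, inv_inv]
  have hT := ThetaF_ne_zero N hN q hq0 hq1 (x ^ 2) hy0 hx2
  have hT' := ThetaF_ne_zero N hN q hq0 hq1 (x ^ 2)⁻¹ (inv_ne_zero hy0) hy'
  set T : ℤ → ℂ := fun k => ThetaF ((q : ℂ) ^ (2 * N)) ((q : ℂ) ^ k * x ^ 2) with hTdef
  set T' : ℤ → ℂ := fun k => ThetaF ((q : ℂ) ^ (2 * N)) ((q : ℂ) ^ k * (x ^ 2)⁻¹) with hTdef'
  replace hT : ∀ k, T k ≠ 0 := hT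
  replace hT' : ∀ k, T' k ≠ 0 := hT'
  set c : ℂ := ((q ^ ((2 : ℝ) / N - 2) : ℝ) : ℂ) with hc
  have hU : ∀ i : ℕ, Ureal N q ((q : ℂ) ^ i * x) =
      c * T (2 * i + 2) * T' (-(2 * i) + 2) / (T (2 * i) * T' (-(2 * i))) := by
    intro i
    have e : (q : ℂ) ^ (2 * (i : ℤ)) = ((q : ℂ) ^ i) ^ 2 := by
      rw [← pow_mul, mul_comm i 2]
      exact_mod_cast zpow_natCast (q : ℂ) (2 * i)
    have e2 : (q : ℂ) ^ (2 : ℤ) = (q : ℂ) ^ 2 := by norm_cast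
    simp only [Ureal, hTdef, hTdef', zpow_add₀ hqc, zpow_neg, e, e2]
    have a1 : (q : ℂ) ^ 2 * ((q : ℂ) ^ i * x) ^ 2 = ((q : ℂ) ^ i) ^ 2 * (q : ℂ) ^ 2 * x ^ 2 := by
      ring
    have a2 : (q : ℂ) ^ 2 * (((q : ℂ) ^ i * x)⁻¹) ^ 2
        = (((q : ℂ) ^ i) ^ 2)⁻¹ * (q : ℂ) ^ 2 * (x ^ 2)⁻¹ := by
      rw [inv_pow, mul_pow, mul_inv]; ring
    have a3 : ((q : ℂ) ^ i * x) ^ 2 = ((q : ℂ) ^ i) ^ 2 * x ^ 2 := by ring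
    have a4 : (((q : ℂ) ^ i * x)⁻¹) ^ 2 = (((q : ℂ) ^ i) ^ 2)⁻¹ * (x ^ 2)⁻¹ := by
      rw [inv_pow, mul_pow, mul_inv]
    rw [a1, a2, a3, a4]
  have hprod : ∀ n : ℕ, ∏ i ∈ Finset.Icc 1 n, Ureal N q ((q : ℂ) ^ i * x)
      = c ^ n * (T (2 * n + 2) / T 2) * (T' 0 / T' (-(2 * n))) := by
    intro n
    induction n with
    | zero => simp [div_self (hT 2), div_self (hT' 0)]
    | succ n ih =>
      rw [Finset.prod_Icc_succ_top (by omega), ih, hU]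
      have b1 : (2 * ((n + 1 : ℕ) : ℤ)) = 2 * n + 2 := by push_cast; ring
      have b2 : -(2 * (n : ℤ) + 2) + 2 = -(2 * n) := by ring
      rw [b1, b2]
      have h1 := hT 2
      have h2 := hT (2 * n + 2)
      have h3 := hT' (-(2 * n))
      have h4 := hT' (-(2 * n + 2))
      field_simp
      ring
  have hsz : (q : ℂ) ^ (2 * (N : ℤ)) = (q : ℂ) ^ (2 * N) := by
    exact_mod_cast zpow_natCast (q : ℂ) (2 * N)
  have hne : ∀ k : ℤ, (q : ℂ) ^ k * x ^ 2 ≠ 1 := by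
    intro k h
    apply hx2 (-k)
    rw [zpow_neg]
    exact eq_inv_of_mul_eq_one_right h
  have hne' : ∀ k : ℤ, (q : ℂ) ^ k * (x ^ 2)⁻¹ ≠ 1 := by
    intro k h
    apply hy' (-k)
    rw [zpow_neg]
    exact eq_inv_of_mul_eq_one_right h
  have s1 : T (2 * N + 2) = -((q : ℂ) ^ (2 : ℤ) * x ^ 2)⁻¹ * T 2 := by
    simp only [hTdef]
    rw [← ThetaF_step _ _ hs hs0 (mul_ne_zero (zpow_ne_zero _ hqc) hy0) (hne 2),
      zpow_add₀ hqc, hsz, mul_assoc]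
  have s2 : T' 0 = -((q : ℂ) ^ (-(2 * (N : ℤ))) * (x ^ 2)⁻¹)⁻¹ * T' (-(2 * N)) := by
    simp only [hTdef']
    rw [← ThetaF_step _ _ hs hs0 (mul_ne_zero (zpow_ne_zero _ hqc) (inv_ne_zero hy0)) (hne' _),
      zpow_neg, hsz, ← mul_assoc, mul_inv_cancel₀ hs0, zpow_zero]
  have hcN : c ^ N * (q : ℂ) ^ (2 * N) = (q : ℂ) ^ 2 := by
    rw [hc]
    norm_cast
    rw [← Real.rpow_natCast, ← Real.rpow_mul hq0.le, ← Real.rpow_natCast, ← Real.rpow_add hq0,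
      ← Real.rpow_natCast]
    congr 1
    have : (N : ℝ) ≠ 0 := by
      have : N ≠ 0 := by omega
      exact_mod_cast this
    push_cast
    field_simp
    ring
  rw [hprod, s1, s2, mul_div_cancel_right₀ _ (hT 2), mul_div_cancel_right₀ _ (hT' _), zpow_neg, hsz]
  have e2 : (q : ℂ) ^ (2 : ℤ) = (q : ℂ) ^ 2 := by norm_cast
  rw [e2]
  field_simp
  linear_combination hcN

end
end

section
/- Let N ≥ 2, ω = e^{2iπ/N}, g^{1/2} the N×N diagonal matrix with entries e^{iπj/N} (1 ≤ j ≤ N), h the shift matrix h_{jl} = δ_{j+1,l} (indices mod N), and S = g^{1/2} h g^{1/2}. For m ∈ ℤ and 1 ≤ k ≤ N, let A_k be the antisymmetrizer on (ℂ^N)^{⊗k}. Then the trace of (S^{−m})^{⊗k} · A_k is nonzero if and only if N divides mk; in particular it vanishes whenever mk is not a multiple of N. -/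
open Complex Matrix Kronecker

noncomputable section

/-- `eπ x = exp(iπx)`; the variables `z, q, p` of the paper are `eπ ξ, eπ ζ, eπ (2τ)`. -/
def eπ (x : ℂ) : ℂ := Complex.exp (Real.pi * Complex.I * x)

/-- Jacobi theta function with characteristics `ϑ[γ₁,γ₂](u,τ)`. -/
def jTheta (γ₁ γ₂ : ℝ) (u τ : ℂ) : ℂ :=
  ∑' m : ℤ, Complex.exp (Real.pi * Complex.I * ((m : ℂ) + (γ₁ : ℂ)) ^ 2 * τ +
    2 * Real.pi * Complex.I * ((m : ℂ) + (γ₁ : ℂ)) * (u + (γ₂ : ℂ)))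

/-- double infinite Pochhammer symbol `(x;p₁,p₂)_∞`. -/
def poch2 (x p₁ p₂ : ℂ) : ℂ := ∏' n : ℕ × ℕ, (1 - x * p₁ ^ n.1 * p₂ ^ n.2)

/-- numerator of `1/κ(z²)`, with `z = eπ ξ`, `q = eπ ζ`, `p = eπ (2τ)`. -/
def kappaNum (N : ℕ) (ξ ζ τ : ℂ) : ℂ :=
  poch2 (eπ (2 * N * ζ - 2 * ξ)) (eπ (2 * τ)) (eπ (2 * N * ζ)) *
  poch2 (eπ (2 * ζ + 2 * ξ)) (eπ (2 * τ)) (eπ (2 * N * ζ)) *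
  poch2 (eπ (2 * τ - 2 * ξ)) (eπ (2 * τ)) (eπ (2 * N * ζ)) *
  poch2 (eπ (2 * τ + (2 * N - 2) * ζ + 2 * ξ)) (eπ (2 * τ)) (eπ (2 * N * ζ))

/-- denominator of `1/κ(z²)`: the numerator with `ξ → -ξ`. -/
def kappaDen (N : ℕ) (ξ ζ τ : ℂ) : ℂ := kappaNum N (-ξ) ζ τ

/-- the diagonal matrix `g^{1/2}` with entries `e^{iπj/N}`, `1 ≤ j ≤ N`. -/
def gHalf (N : ℕ) : Matrix (Fin N) (Fin N) ℂ :=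
  Matrix.diagonal fun j => eπ ((((j : ℕ) : ℂ) + 1) / N)

/-- the diagonal matrix `g` with entries `ω^j = e^{2iπj/N}`, `1 ≤ j ≤ N`. -/
def gMat (N : ℕ) : Matrix (Fin N) (Fin N) ℂ :=
  Matrix.diagonal fun j => eπ (2 * (((j : ℕ) : ℂ) + 1) / N)

/-- the shift matrix `h`, `h_{jl} = δ_{j+1,l}` (mod `N`). -/
def hMat (N : ℕ) : Matrix (Fin N) (Fin N) ℂ :=
  Matrix.of fun j l => if (l : ℕ) = ((j : ℕ) + 1) % N then 1 else 0

/-- `I_{(α₁,α₂)} = g^{α₂} h^{α₁}`. -/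
def Imat (N : ℕ) (α : Fin N × Fin N) : Matrix (Fin N) (Fin N) ℂ :=
  gMat N ^ (α.2 : ℕ) * hMat N ^ (α.1 : ℕ)

/-- the coefficient `W_{(α₁,α₂)}(ξ,ζ,τ)`. -/
def Wcoef (N : ℕ) (α : Fin N × Fin N) (ξ ζ τ : ℂ) : ℂ :=
  jTheta (1/2 + (α.1 : ℕ) / N) (1/2 + (α.2 : ℕ) / N) (ξ + ζ / N) τ /
    (N * jTheta (1/2 + (α.1 : ℕ) / N) (1/2 + (α.2 : ℕ) / N) (ζ / N) τ)

/-- the matrix `𝒵(z)`, `z = eπ ξ`. -/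
def Zmat (N : ℕ) (ξ ζ τ : ℂ) : Matrix (Fin N × Fin N) (Fin N × Fin N) ℂ :=
  (eπ (ξ * (2 / N - 2)) * (kappaNum N ξ ζ τ / kappaDen N ξ ζ τ) *
      jTheta (1/2) (1/2) ζ τ / jTheta (1/2) (1/2) (ξ + ζ) τ) •
    ∑ α : Fin N × Fin N, Wcoef N α ξ ζ τ • (Imat N α ⊗ₖ (Imat N α)⁻¹)

/-- the Belavin R-matrix `R(z)`, as a function of `ξ` with `z = eπ ξ`. -/
def Rmat (N : ℕ) (ξ ζ τ : ℂ) : Matrix (Fin N × Fin N) (Fin N × Fin N) ℂ :=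
  (gHalf N ⊗ₖ gHalf N) * Zmat N ξ ζ τ * (gHalf N ⊗ₖ gHalf N)⁻¹

/-- genericity: every theta-function value and κ-value appearing in a denominator is nonzero. -/
def Rgeneric (N : ℕ) (ξ ζ τ : ℂ) : Prop :=
  jTheta (1/2) (1/2) (ξ + ζ) τ ≠ 0 ∧
  (∀ α : Fin N × Fin N,
    jTheta (1/2 + (α.1 : ℕ) / N) (1/2 + (α.2 : ℕ) / N) (ζ / N) τ ≠ 0) ∧
  kappaDen N ξ ζ τ ≠ 0

/-- the flip (permutation) operator `P` on `ℂ^N ⊗ ℂ^N`. -/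
def Pflip (N : ℕ) : Matrix (Fin N × Fin N) (Fin N × Fin N) ℂ :=
  Matrix.of fun a b => if a.1 = b.2 ∧ a.2 = b.1 then 1 else 0

/-- partial transposition in the second tensor factor. -/
def pt2 {N : ℕ} (M : Matrix (Fin N × Fin N) (Fin N × Fin N) ℂ) :
    Matrix (Fin N × Fin N) (Fin N × Fin N) ℂ :=
  Matrix.of fun a b => M (a.1, b.2) (b.1, a.2)

/-- `τ_N` evaluated at `eπ u` (all fractional powers via exponentials). -/
def tauNe (N : ℕ) (ζ u : ℂ) : ℂ :=
  eπ (u * (2 / N - 2)) * ThetaF (eπ (2 * N * ζ)) (eπ (ζ + 2 * u)) /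
    ThetaF (eπ (2 * N * ζ)) (eπ (ζ - 2 * u))

/-- the normalized Belavin R-matrix `R̂(z) = τ_N(q^{1/2}z⁻¹) R(z)`, as a function of `ξ`. -/
def Rhat (N : ℕ) (ξ ζ τ : ℂ) : Matrix (Fin N × Fin N) (Fin N × Fin N) ℂ :=
  tauNe N ζ (ζ / 2 - ξ) • Rmat N ξ ζ τ


/-- the permutation operator `P_σ` on `(ℂ^N)^{⊗k}`:
`P_σ (v₁ ⊗ ⋯ ⊗ v_k) = v_{σ⁻¹(1)} ⊗ ⋯ ⊗ v_{σ⁻¹(k)}`. -/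
def Pperm (N k : ℕ) (σ : Equiv.Perm (Fin k)) :
    Matrix (Fin k → Fin N) (Fin k → Fin N) ℂ :=
  Matrix.of fun a b => if a = b ∘ σ.symm then 1 else 0

/-- the antisymmetrizer `A_k = (1/k!) Σ_σ sgn(σ) P_σ` on `(ℂ^N)^{⊗k}`. -/
def asym (N k : ℕ) : Matrix (Fin k → Fin N) (Fin k → Fin N) ℂ :=
  (k.factorial : ℂ)⁻¹ • ∑ σ : Equiv.Perm (Fin k),
    (((Equiv.Perm.sign σ : ℤ) : ℂ)) • Pperm N k σ

/-- the `k`-fold tensor (Kronecker) power `M^{⊗k}` of an `N×N` matrix. -/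
def tensPow (N k : ℕ) (M : Matrix (Fin N) (Fin N) ℂ) :
    Matrix (Fin k → Fin N) (Fin k → Fin N) ℂ :=
  Matrix.of fun a b => ∏ i, M (a i) (b i)

lemma tensPow_mul (N k : ℕ) (A B : Matrix (Fin N) (Fin N) ℂ) :
    tensPow N k (A * B) = tensPow N k A * tensPow N k B := by
  ext a b
  simp only [tensPow, Matrix.of_apply, Matrix.mul_apply]
  rw [Finset.prod_univ_sum]
  simp [Fintype.piFinset_univ, Finset.prod_mul_distrib]

lemma tensPow_one (N k : ℕ) : tensPow N k 1 = 1 := by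
  ext a b
  simp only [tensPow, Matrix.of_apply, Matrix.one_apply]
  rw [Finset.prod_ite_zero]
  simp [funext_iff]

lemma tensPow_mul_Pperm (N k : ℕ) (σ : Equiv.Perm (Fin k)) (M : Matrix (Fin N) (Fin N) ℂ)
    (a b : Fin k → Fin N) :
    (tensPow N k M * Pperm N k σ) a b = ∏ i, M (a i) (b (σ.symm i)) := by
  simp [tensPow, Pperm, Matrix.mul_apply]

lemma Pperm_mul_tensPow (N k : ℕ) (σ : Equiv.Perm (Fin k)) (M : Matrix (Fin N) (Fin N) ℂ)
    (a b : Fin k → Fin N) :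
    (Pperm N k σ * tensPow N k M) a b = ∏ i, M (a (σ i)) (b i) := by
  simp only [tensPow, Pperm, Matrix.mul_apply, Matrix.of_apply, ite_mul, one_mul, zero_mul]
  rw [Finset.sum_eq_single (a ∘ σ)]
  · rw [if_pos]
    · rfl
    · ext i; simp
  · intro c _ hc
    rw [if_neg]
    rintro rfl
    apply hc
    ext i; simp
  · simp

lemma asym_comm (N k : ℕ) (M : Matrix (Fin N) (Fin N) ℂ) :
    tensPow N k M * asym N k = asym N k * tensPow N k M := by
  simp only [asym, Matrix.mul_smul, Matrix.smul_mul, Finset.mul_sum, Finset.sum_mul]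
  congr 1
  refine Finset.sum_congr rfl fun σ _ => ?_
  congr 1
  ext a b
  rw [tensPow_mul_Pperm, Pperm_mul_tensPow, ← Equiv.prod_comp σ]
  simp

lemma trace_conj (N k : ℕ) (M V D : Matrix (Fin N) (Fin N) ℂ) (hV : IsUnit V.det)
    (h : V * D = M * V) :
    Matrix.trace (tensPow N k M * asym N k) = Matrix.trace (tensPow N k D * asym N k) := by
  have hM : M = V * D * V⁻¹ := by
    rw [h, Matrix.mul_assoc, Matrix.mul_nonsing_inv _ hV, Matrix.mul_one]
  rw [hM, tensPow_mul, tensPow_mul, Matrix.mul_assoc, asym_comm, ← Matrix.mul_assoc,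
    Matrix.trace_mul_comm, ← Matrix.mul_assoc, ← Matrix.mul_assoc, ← tensPow_mul,
    Matrix.nonsing_inv_mul _ hV, tensPow_one, Matrix.one_mul]

lemma trace_diag (N k : ℕ) (d : Fin N → ℂ) :
    Matrix.trace (tensPow N k (Matrix.diagonal d) * asym N k) =
      ∑ t ∈ (Finset.univ : Finset (Fin N)).powersetCard k, ∏ i ∈ t, d i := by
  classical
  have h1 : Matrix.trace (tensPow N k (Matrix.diagonal d) * asym N k) =
      (k.factorial : ℂ)⁻¹ * ∑ a : Fin k → Fin N,
        if Function.Injective a then ∏ i, d (a i) else 0 := by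
    simp only [asym, Matrix.mul_smul, Finset.mul_sum, Matrix.trace_smul, Matrix.trace_sum,
      smul_eq_mul]
    rw [← Finset.mul_sum, ← Finset.mul_sum]
    congr 1
    simp only [Matrix.trace, Matrix.diag, tensPow_mul_Pperm, Finset.mul_sum]
    rw [Finset.sum_comm]
    refine Finset.sum_congr rfl fun a _ => ?_
    have h2 : ∑ σ : Equiv.Perm (Fin k), (((Equiv.Perm.sign σ : ℤ) : ℂ)) *
        ∏ i, Matrix.diagonal d (a i) (a (σ.symm i)) =
        (Matrix.of fun i j => Matrix.diagonal d (a i) (a j)).det := by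
      rw [Matrix.det_apply', ← Equiv.sum_comp (Equiv.inv (Equiv.Perm (Fin k)))]
      refine Finset.sum_congr rfl fun σ _ => ?_
      simp only [Equiv.inv_apply, Equiv.Perm.sign_inv, Matrix.of_apply]
      congr 1
      refine Finset.prod_congr rfl fun i _ => ?_
      rw [← Matrix.diagonal_transpose, Matrix.transpose_apply, Matrix.diagonal_transpose]
      rfl
    rw [h2]
    split_ifs with hinj
    · have : (Matrix.of fun i j => Matrix.diagonal d (a i) (a j)) =
          Matrix.diagonal fun i => d (a i) := by
        ext i j
        simp [Matrix.diagonal_apply, hinj.eq_iff]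
      rw [this, Matrix.det_diagonal]
    · simp only [Function.Injective, not_forall] at hinj
      obtain ⟨i, j, hij, hne⟩ := hinj
      apply Matrix.det_zero_of_row_eq hne
      ext l
      simp [hij]
  rw [h1, ← Finset.sum_filter]
  have hk : (k.factorial : ℂ) ≠ 0 := by exact_mod_cast k.factorial_ne_zero
  rw [inv_mul_eq_iff_eq_mul₀ hk, Finset.mul_sum]
  rw [← Finset.sum_fiberwise_of_maps_to
    (t := (Finset.univ : Finset (Fin N)).powersetCard k)
    (g := fun a : Fin k → Fin N => Finset.univ.image a)]
  · refine Finset.sum_congr rfl fun t ht => ?_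
    rw [Finset.mem_powersetCard] at ht
    have hc : ∀ a ∈ ((Finset.univ.filter fun a : Fin k → Fin N => Function.Injective a).filter
        fun a => Finset.univ.image a = t), ∏ i, d (a i) = ∏ i ∈ t, d i := by
      intro a ha
      simp only [Finset.mem_filter, Finset.mem_univ, true_and] at ha
      rw [← ha.2, Finset.prod_image (fun x _ y _ h => ha.1 h)]
    rw [Finset.sum_congr rfl hc, Finset.sum_const, nsmul_eq_mul]
    congr 2
    rw [← Fintype.card_coe]
    have e : Fin k ≃ t := (Finset.equivFinOfCardEq ht.2).symm
    rw [← Fintype.card_fin k, ← Fintype.card_equiv e, Fintype.card_fin]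
    symm
    refine Fintype.card_of_bijective
      (f := fun f : Fin k ≃ t => ⟨fun i => (f i : Fin N), ?_⟩) ⟨?_, ?_⟩
    · simp only [Finset.mem_filter, Finset.mem_univ, true_and]
      refine ⟨fun x y h => f.injective (Subtype.ext h), ?_⟩
      ext x
      simp only [Finset.mem_image, Finset.mem_univ, true_and]
      constructor
      · rintro ⟨i, rfl⟩; exact (f i).2
      · intro hx; exact ⟨f.symm ⟨x, hx⟩, by simp⟩
    · intro f g hfg
      ext i
      have := congrFun (congrArg Subtype.val hfg) i
      exact congrArg Fin.val this
    · rintro ⟨a, ha⟩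
      simp only [Finset.mem_filter, Finset.mem_univ, true_and] at ha
      have hmem : ∀ i, a i ∈ t := fun i => by
        rw [← ha.2]; exact Finset.mem_image_of_mem _ (Finset.mem_univ _)
      refine ⟨Equiv.ofBijective (fun i => (⟨a i, hmem i⟩ : t)) ⟨?_, ?_⟩, ?_⟩
      · intro x y h
        exact ha.1 (congrArg Subtype.val h)
      · rintro ⟨x, hx⟩
        rw [← ha.2] at hx
        simp only [Finset.mem_image, Finset.mem_univ, true_and] at hx
        obtain ⟨i, hi⟩ := hx
        exact ⟨i, Subtype.ext hi⟩
      · rfl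
  · intro a ha
    simp only [Finset.mem_filter, Finset.mem_univ, true_and] at ha
    simp [Finset.mem_powersetCard, Finset.card_image_of_injective _ ha]

lemma prod_primitive (r : ℕ) (hr : 0 < r) (ζ c : ℂ) (hζ : IsPrimitiveRoot ζ r) :
    ∏ j ∈ Finset.range r, (Polynomial.X + Polynomial.C (c * ζ ^ j)) =
      (Polynomial.X ^ r - Polynomial.C ((-c) ^ r) : Polynomial ℂ) := by
  have hζ' : IsPrimitiveRoot (Polynomial.C ζ : Polynomial ℂ) r :=
    hζ.map_of_injective Polynomial.C_injective
  rw [Polynomial.C_pow, hζ'.pow_sub_pow_eq_prod_sub_mul _ _ hr]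
  have himg : Polynomial.nthRootsFinset r (1 : Polynomial ℂ) =
      (Finset.range r).image (fun j => (Polynomial.C ζ : Polynomial ℂ) ^ j) := by
    symm
    apply Finset.eq_of_subset_of_card_le
    · intro x hx
      simp only [Finset.mem_image, Finset.mem_range] at hx
      obtain ⟨j, _, rfl⟩ := hx
      rw [Polynomial.mem_nthRootsFinset hr, ← pow_mul, mul_comm, pow_mul, hζ'.pow_eq_one, one_pow]
    · rw [hζ'.card_nthRootsFinset, Finset.card_image_of_injOn, Finset.card_range]
      intro x hx y hy h
      exact hζ'.pow_inj (by simpa using hx) (by simpa using hy) h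
  rw [himg, Finset.prod_image]
  · refine Finset.prod_congr rfl fun j _ => ?_
    simp
    ring
  · intro x hx y hy h
    exact hζ'.pow_inj (by simpa using hx) (by simpa using hy) h

lemma prod_periodic {R : Type*} [CommMonoid R] (f : ℕ → R) (r d : ℕ)
    (hf : ∀ j, f (j + r) = f j) :
    ∏ j ∈ Finset.range (r * d), f j = (∏ j ∈ Finset.range r, f j) ^ d := by
  induction d with
  | zero => simp
  | succ d ih =>
    rw [Nat.mul_succ, Finset.prod_range_add, ih, pow_succ]
    congr 1
    refine Finset.prod_congr rfl fun j _ => ?_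
    clear ih
    induction d with
    | zero => simp
    | succ d ih => rw [Nat.mul_succ, ← ih, ← hf (r * d + j)]; congr 1; ring

lemma esymm_ne_zero_iff (N k : ℕ) (hN : 0 < N) (hk : k ≤ N) (ζ c : ℂ) (hc : c ≠ 0)
    (hζ : ζ ^ N = 1) :
    ∑ t ∈ (Finset.univ : Finset (Fin N)).powersetCard k, ∏ i ∈ t, (c * ζ ^ (i : ℕ)) ≠ 0 ↔
      ζ ^ k = 1 := by
  have hr : 0 < orderOf ζ := orderOf_pos_iff.2 (isOfFinOrder_iff_pow_eq_one.2 ⟨N, hN, hζ⟩)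
  have hprim : IsPrimitiveRoot ζ (orderOf ζ) := IsPrimitiveRoot.orderOf ζ
  obtain ⟨d, hd⟩ := orderOf_dvd_of_pow_eq_one hζ
  rw [← orderOf_dvd_iff_pow_eq_one]
  set r := orderOf ζ with hrdef
  have hv := Finset.prod_X_add_C_coeff (Finset.univ : Finset (Fin N))
    (fun i => c * ζ ^ (i : ℕ)) (k := N - k) (by simp)
  rw [Finset.card_univ, Fintype.card_fin, Nat.sub_sub_self hk] at hv
  rw [← hv, Fin.prod_univ_eq_prod_range
    (fun j => (Polynomial.X + Polynomial.C (c * ζ ^ j) : Polynomial ℂ)) N, hd,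
    prod_periodic _ r d, prod_primitive r hr ζ c hprim]
  · have hexp : ((Polynomial.X ^ r - Polynomial.C ((-c) ^ r)) ^ d : Polynomial ℂ) =
        Polynomial.expand ℂ r ((Polynomial.X + Polynomial.C (-(-c) ^ r)) ^ d) := by
      simp [sub_eq_add_neg]
    rw [hexp, Polynomial.coeff_expand hr]
    have hdvd : r ∣ r * d - k ↔ r ∣ k := by
      rw [Nat.dvd_sub_iff_right (by omega) (dvd_mul_right r d)]
    simp only [hdvd]
    split_ifs with h
    · simp only [h, iff_true]
      rw [Polynomial.coeff_X_add_C_pow]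
      refine mul_ne_zero (pow_ne_zero _ (by simpa using fun h => absurd h hc)) ?_
      have : (r * d - k) / r ≤ d := by
        apply Nat.div_le_of_le_mul; omega
      exact_mod_cast (Nat.choose_pos this).ne'
    · simp [h]
  · intro j
    rw [pow_add, hprim.pow_eq_one, mul_one]

lemma diagonal_zpow' (N : ℕ) (d : Fin N → ℂ) (hd : ∀ i, d i ≠ 0) (z : ℤ) :
    (Matrix.diagonal d) ^ z = Matrix.diagonal fun i => d i ^ z := by
  obtain ⟨n, rfl | rfl⟩ := z.eq_nat_or_neg
  · simp [Matrix.diagonal_pow]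
  · rw [Matrix.zpow_neg_natCast]
    apply Matrix.inv_eq_right_inv
    rw [Matrix.diagonal_pow, Matrix.diagonal_mul_diagonal, ← Matrix.diagonal_one]
    congr 1
    ext i
    simp [hd i]

lemma eπ_add (x y : ℂ) : eπ (x + y) = eπ x * eπ y := by
  simp [eπ, mul_add, Complex.exp_add]

lemma eπ_int_mul (n : ℤ) (x : ℂ) : eπ (n * x) = eπ x ^ n := by
  rw [eπ, eπ, ← Complex.exp_int_mul]; congr 1; ring

lemma eπ_nat_mul (n : ℕ) (x : ℂ) : eπ (n * x) = eπ x ^ n := by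
  rw [eπ, eπ, ← Complex.exp_nat_mul]; congr 1; ring

lemma eπ_ne_zero (x : ℂ) : eπ x ≠ 0 := Complex.exp_ne_zero _

lemma eπ_even (n : ℤ) : eπ (2 * n) = 1 := by
  rw [eπ, Complex.exp_eq_one_iff]; exact ⟨n, by ring⟩

lemma eπ_congr {x y : ℂ} (n : ℤ) (h : x = y + 2 * n) : eπ x = eπ y := by
  rw [h, eπ_add, eπ_even, mul_one]

lemma eπ_prim (N : ℕ) (hN : N ≠ 0) : IsPrimitiveRoot (eπ (2 / N)) N := by
  have := Complex.isPrimitiveRoot_exp N hN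
  rw [eπ]
  convert this using 2
  ring

/-- Eigenvalues of `S`. -/
def eigS (N : ℕ) (j : Fin N) : ℂ := eπ (((N : ℂ) - 1) / N + 2 * (j : ℕ) / N)

/-- Eigenvectors of `S`. -/
def eigV (N : ℕ) : Matrix (Fin N) (Fin N) ℂ :=
  Matrix.of fun l j => eπ (-(((l : ℕ) : ℂ) + 1) ^ 2 / N + ((N : ℂ) - 1) / N * (l : ℕ)
    + 2 * (j : ℕ) * (l : ℕ) / N)

lemma eigV_det (N : ℕ) (hN : 2 ≤ N) : IsUnit (eigV N).det := by
  have hN0 : (N : ℂ) ≠ 0 := by exact_mod_cast (by omega : N ≠ 0)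
  have : eigV N = Matrix.diagonal (fun l : Fin N =>
      eπ (-(((l : ℕ) : ℂ) + 1) ^ 2 / N + ((N : ℂ) - 1) / N * (l : ℕ))) *
      Matrix.vandermonde (fun l : Fin N => eπ (2 / N) ^ (l : ℕ)) := by
    ext l j
    rw [Matrix.diagonal_mul, Matrix.vandermonde_apply, ← pow_mul, ← eπ_nat_mul, ← eπ_add, eigV,
      Matrix.of_apply]
    congr 1
    push_cast
    ring
  rw [this, Matrix.det_mul, isUnit_iff_ne_zero, Matrix.det_diagonal]
  refine mul_ne_zero (Finset.prod_ne_zero_iff.2 fun i _ => eπ_ne_zero _) ?_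
  rw [Matrix.det_vandermonde_ne_zero_iff]
  intro x y h
  exact Fin.ext ((eπ_prim N (by omega)).pow_inj x.2 y.2 h)

lemma eigV_spec (N : ℕ) (hN : 2 ≤ N) :
    eigV N * Matrix.diagonal (eigS N) = (gHalf N * hMat N * gHalf N) * eigV N := by
  have hN0 : (N : ℂ) ≠ 0 := by exact_mod_cast (by omega : N ≠ 0)
  ext l j
  rw [Matrix.mul_diagonal, Matrix.mul_apply]
  have hlt : ((l : ℕ) + 1) % N < N := Nat.mod_lt _ (by omega)
  rw [Finset.sum_eq_single (⟨((l : ℕ) + 1) % N, hlt⟩ : Fin N)]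
  · rw [gHalf, Matrix.mul_diagonal, Matrix.diagonal_mul]
    simp only [hMat, eigV, eigS, Matrix.of_apply, if_true, mul_one]
    rw [← eπ_add, ← eπ_add, ← eπ_add]
    rcases Nat.lt_or_ge ((l : ℕ) + 1) N with h | h
    · rw [Nat.mod_eq_of_lt h]
      congr 1
      push_cast
      field_simp
      ring
    · have hl : (l : ℕ) + 1 = N := by omega
      have hl' : ((l : ℕ) : ℂ) = N - 1 := by 
        rw [eq_sub_iff_add_eq]; exact_mod_cast hl
      rw [hl, Nat.mod_self, hl']
      refine eπ_congr ((j : ℕ) - 1) ?_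
      push_cast
      field_simp
      ring
  · intro b _ hb
    rw [gHalf, Matrix.mul_diagonal, Matrix.diagonal_mul]
    have : (b : ℕ) ≠ ((l : ℕ) + 1) % N := fun h => hb (Fin.ext h)
    simp [hMat, this]
  · simp

/-- `tr((S^{-m})^{⊗k} A_k) ≠ 0` iff `N ∣ mk`, where `S = g^{1/2} h g^{1/2}`. -/
theorem trace_tensPow_antisymmetrizer_ne_zero_iff (N k : ℕ) (hN : 2 ≤ N)
    (hk1 : 1 ≤ k) (hkN : k ≤ N) (m : ℤ) :
    Matrix.trace (tensPow N k ((gHalf N * hMat N * gHalf N) ^ (-m)) * asym N k) ≠ 0 ↔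
      (N : ℤ) ∣ m * k := by
  have hN0 : (N : ℂ) ≠ 0 := by exact_mod_cast (by omega : N ≠ 0)
  have hV := eigV_det N hN
  have hspec := eigV_spec N hN
  have hD : IsUnit (Matrix.diagonal (eigS N)).det := by
    rw [Matrix.det_diagonal, isUnit_iff_ne_zero]
    exact Finset.prod_ne_zero_iff.2 fun i _ => eπ_ne_zero _
  have hS : IsUnit (gHalf N * hMat N * gHalf N).det := by
    have h := congrArg Matrix.det hspec
    rw [Matrix.det_mul, Matrix.det_mul _ (eigV N)] at h
    exact isUnit_of_mul_isUnit_left (h ▸ hV.mul hD)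
  have hsc := Matrix.SemiconjBy.zpow_right hD hS hspec (-m)
  rw [trace_conj N k _ _ _ hV hsc, diagonal_zpow' N (eigS N) (fun i => eπ_ne_zero _), trace_diag]
  have hd : ∀ i : Fin N, eigS N i ^ (-m) =
      eπ (((N : ℂ) - 1) / N) ^ (-m) * (eπ (2 / N) ^ (-m)) ^ (i : ℕ) := by
    intro i
    rw [← zpow_natCast, ← _root_.zpow_mul, mul_comm (-m), _root_.zpow_mul, ← mul_zpow, zpow_natCast,
      ← eπ_nat_mul, ← eπ_add, eigS]
    congr 2
    ring
  have hp := eπ_prim N (by omega)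
  simp only [hd]
  rw [esymm_ne_zero_iff N k (by omega) hkN _ _ (zpow_ne_zero _ (eπ_ne_zero _)), ← zpow_natCast,
    ← _root_.zpow_mul, hp.zpow_eq_one_iff_dvd, neg_mul, dvd_neg]
  rw [← zpow_natCast, ← _root_.zpow_mul, hp.zpow_eq_one_iff_dvd]
  exact dvd_mul_left _ _

end
end
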